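/- Let n be a positive integer with n ≡ 5 (mod 6). Then, as rational functions in the two variables a and q over ℚ, ∑_{k=0}^{n−1} (a^5 q; q^6)_k (q/a^5; q^6)_k (q^4; q^6)_k · q^{6k} / ( (a^4 q^6; q^6)_k (q^6/a^4; q^6)_k (q^6; q^6)_k ) ≡ 0 (mod (1 − a q^n)(a − q^n)). -/

import Mathlib

open Finset

/-- Polynomials in the two variables `a` (index 0) and `q` (index 1) over `ℚ`. -/
abbrev MvP : Type := MvPolynomial (Fin 2) ℚ

/-- The field of rational functions in the two variables `a` and `q` over `ℚ`. -/
abbrev FF : Type := FractionRing MvP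

/-- The variable `a`, viewed in the field of rational functions. -/
noncomputable def av : FF := algebraMap MvP FF (MvPolynomial.X 0)

/-- The variable `q`, viewed in the field of rational functions. -/
noncomputable def qv : FF := algebraMap MvP FF (MvPolynomial.X 1)

/-- The q-shifted factorial `(x; q)_k = ∏_{j=0}^{k-1} (1 - x q^j)`. -/
noncomputable def poch (x q : FF) (k : ℕ) : FF :=
  ∏ j ∈ Finset.range k, (1 - x * q ^ j)

/-- `A ≡ 0 (mod P)`: `A = P · (B / C)` where the denominator `C` is coprime
(has no common non-unit factor) with `P`. -/
def CongrZero (A : FF) (P : MvP) : Prop :=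
  ∃ B C : MvP, C ≠ 0 ∧ IsRelPrime C P ∧
    A = algebraMap MvP FF P * (algebraMap MvP FF B / algebraMap MvP FF C)

section SaalschutzVanishing

variable {K : Type*} [Field K]

/-- The `q`-shifted factorial over an arbitrary field. -/
def qPoch (x q : K) (k : ℕ) : K :=
  ∏ j ∈ Finset.range k, (1 - x * q ^ j)

lemma qPoch_zero (x q : K) : qPoch x q 0 = 1 := by simp [qPoch]

lemma qPoch_succ (x q : K) (k : ℕ) : qPoch x q (k + 1) = qPoch x q k * (1 - x * q ^ k) :=
  Finset.prod_range_succ _ _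

lemma qPoch_succ' (x q : K) (k : ℕ) :
    qPoch x q (k + 1) = (1 - x) * qPoch (x * q) q k := by
  rw [qPoch, Finset.prod_range_succ', mul_comm]
  simp only [qPoch, pow_zero, mul_one]
  congr 1
  exact Finset.prod_congr rfl fun j _ => by ring

lemma qPoch_ne_zero {x q : K} {k : ℕ} (h : ∀ j, 1 - x * q ^ j ≠ 0) : qPoch x q k ≠ 0 :=
  Finset.prod_ne_zero_iff.mpr fun j _ => h j

lemma qPoch_eq_zero {x q : K} {k j : ℕ} (hj : j < k) (h : x * q ^ j = 1) : qPoch x q k = 0 :=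
  Finset.prod_eq_zero (Finset.mem_range.mpr hj) (by rw [h, sub_self])

/-- The partial sums of the balanced `₃φ₂` series with upper parameters `a, b, x`, lower
parameters `c, d * x` and base `p`. -/
def saalSum (a b c d p x : K) (n : ℕ) : K :=
  ∑ k ∈ Finset.range n, qPoch a p k * qPoch b p k * qPoch x p k * p ^ k
    / (qPoch c p k * qPoch (d * x) p k * qPoch p p k)

/-- A contiguous relation between partial sums of balanced `₃φ₂` series. -/
lemma saalSum_contiguous {a b c d p x : K} (ha : a ≠ 0) (hp : p ≠ 0)
    (hbal : c * d = a * b * p) (hc : ∀ j, 1 - c * p ^ j ≠ 0) (hd : ∀ j, 1 - d * x * p ^ j ≠ 0)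
    (hpp : ∀ j, 1 - p * p ^ j ≠ 0) (N : ℕ) :
    c * (x * p - c) * (d * x - 1) * saalSum a b c d p x (N + 1)
      - (a * x * p - c) * (b * x * p - c) * saalSum a b c d p (x * p) (N + 1)
      = -(c * x * p) * (qPoch a p (N + 1) * qPoch b p (N + 1) * qPoch (x * p) p N)
          / (qPoch c p N * qPoch (d * x * p) p N * qPoch p p N) := by
  have hd' : ∀ j, 1 - d * x * p * p ^ j ≠ 0 := fun j => by
    have := hd (j + 1)
    rwa [pow_succ', ← mul_assoc] at this
  have hb : b = c * d / (a * p) := by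
    rw [hbal]; field_simp
  induction N with
  | zero =>
    simp only [saalSum, qPoch_succ, qPoch_zero, zero_add, Finset.sum_range_one]
    simp only [pow_zero, mul_one, one_mul, div_one]
    linear_combination (x ^ 2 * p - c * x) * hbal
  | succ N ih =>
    have es : ∀ y, saalSum a b c d p y (N + 1 + 1) = saalSum a b c d p y (N + 1)
        + qPoch a p (N + 1) * qPoch b p (N + 1) * qPoch y p (N + 1) * p ^ (N + 1)
          / (qPoch c p (N + 1) * qPoch (d * y) p (N + 1) * qPoch p p (N + 1)) :=
      fun y => Finset.sum_range_succ _ _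
    rw [es, es]
    have e1 : qPoch x p (N + 1) = (1 - x) * qPoch (x * p) p N := qPoch_succ' _ _ _
    have e2 : qPoch (d * x) p (N + 1) = (1 - d * x) * qPoch (d * x * p) p N := qPoch_succ' _ _ _
    have key : c * (x * p - c) * (d * x - 1) *
          ((1 - x) * (p * p ^ N) / ((1 - c * p ^ N) * (1 - d * x) * (1 - p * p ^ N)))
        - (a * x * p - c) * (b * x * p - c) * ((1 - x * p * p ^ N) * (p * p ^ N)
          / ((1 - c * p ^ N) * (1 - d * x * p * p ^ N) * (1 - p * p ^ N)))
        = -(c * x * p) * ((1 - a * (p * p ^ N)) * (1 - b * (p * p ^ N)) * (1 - x * p * p ^ N))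
          / ((1 - c * p ^ N) * (1 - d * x * p * p ^ N) * (1 - p * p ^ N)) + c * x * p := by
      have h1 := hc N
      have h2 := hd' N
      have h3 := hpp N
      have h4 : 1 - d * x ≠ 0 := by simpa using hd 0
      generalize p ^ N = u at *
      subst hb
      generalize hE : 1 - d * x * p * u = E at *
      generalize hF : 1 - d * x = F at *
      generalize hG : 1 - c * u = G at *
      generalize hH : 1 - p * u = H at *
      field_simp
      rw [← hE, ← hF, ← hG, ← hH]
      ring
    have e3 : d * (x * p) = d * x * p := by ring
    rw [e3, e1, e2]
    rw [qPoch_succ a p (N + 1), qPoch_succ b p (N + 1), qPoch_succ (x * p) p N, qPoch_succ c p N,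
      qPoch_succ (d * x * p) p N, qPoch_succ p p N]
    simp only [pow_succ']
    have := congrArg (fun t => t * (qPoch a p (N + 1) * qPoch b p (N + 1) * qPoch (x * p) p N)
          / (qPoch c p N * qPoch (d * x * p) p N * qPoch p p N)) key
    clear key e1 e2 es
    generalize 1 - d * x * p * p ^ N = E at *
    generalize 1 - d * x = F at *
    generalize 1 - c * p ^ N = G at *
    generalize 1 - p * p ^ N = H at *
    linear_combination ih + this

/-- A vanishing instance of the `q`-Saalschütz sum. -/
lemma saalSum_eq_zero {Q : K} (hQ : Q ≠ 0) (hQ1 : ∀ z : ℤ, Q ^ z = 1 → z = 0) (j r : ℕ)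
    (hr : r ≤ 4 * j + 3) :
    saalSum (Q ^ (30 * j + 26 : ℤ)) (Q ^ (4 : ℤ)) (Q ^ (24 * j + 26 : ℤ)) (Q ^ (6 * j + 10 : ℤ))
      (Q ^ (6 : ℤ)) (Q ^ (-6 * (j + 1 + r) : ℤ)) (6 * j + 4 + 1) = 0 := by
  have ne1 : ∀ z : ℤ, z ≠ 0 → 1 - Q ^ z ≠ 0 := fun z hz h => hz (hQ1 z (sub_eq_zero.mp h).symm)
  have inj : ∀ z w : ℤ, Q ^ z = Q ^ w → z = w := fun z w h => by
    have := hQ1 (z - w) (by rw [zpow_sub₀ hQ, h, div_self (zpow_ne_zero _ hQ)])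
    omega
  have hbal : Q ^ (24 * j + 26 : ℤ) * Q ^ (6 * j + 10 : ℤ)
      = Q ^ (30 * j + 26 : ℤ) * Q ^ (4 : ℤ) * Q ^ (6 : ℤ) := by
    simp only [← zpow_add₀ hQ]
    congr 1
    ring
  have contig := saalSum_contiguous (x := Q ^ (-6 * (j + 1 + r) : ℤ)) (zpow_ne_zero _ hQ)
    (zpow_ne_zero _ hQ) hbal
    (fun i => by
      simp only [← zpow_natCast, ← zpow_mul, ← zpow_add₀ hQ]
      exact ne1 _ (by omega))
    (fun i => by
      simp only [← zpow_natCast, ← zpow_mul, ← zpow_add₀ hQ]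
      exact ne1 _ (by omega))
    (fun i => by
      simp only [← zpow_natCast, ← zpow_mul, ← zpow_add₀ hQ]
      exact ne1 _ (by omega)) (6 * j + 4)
  have hterm : qPoch (Q ^ (-6 * (j + 1 + r) : ℤ) * Q ^ (6 : ℤ)) (Q ^ (6 : ℤ)) (6 * j + 4) = 0 := by
    refine qPoch_eq_zero (j := j + r) (by omega) ?_
    simp only [← zpow_natCast, ← zpow_mul, ← zpow_add₀ hQ]
    rw [← zpow_zero Q]
    congr 1
    push_cast
    ring
  have hprod : (Q ^ (30 * j + 26 : ℤ) * Q ^ (-6 * (j + 1 + r) : ℤ) * Q ^ (6 : ℤ)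
        - Q ^ (24 * j + 26 : ℤ))
      * saalSum (Q ^ (30 * j + 26 : ℤ)) (Q ^ (4 : ℤ)) (Q ^ (24 * j + 26 : ℤ))
        (Q ^ (6 * j + 10 : ℤ)) (Q ^ (6 : ℤ)) (Q ^ (-6 * (j + 1 + r) : ℤ) * Q ^ (6 : ℤ))
        (6 * j + 4 + 1) = 0 := by
    cases r with
    | zero =>
      refine mul_eq_zero_of_left (sub_eq_zero.mpr ?_) _
      simp only [← zpow_add₀ hQ]
      congr 1
      push_cast
      ring
    | succ r =>
      refine mul_eq_zero_of_right _ ?_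
      have e : Q ^ (-6 * (j + 1 + (r + 1 : ℕ)) : ℤ) * Q ^ (6 : ℤ)
          = Q ^ (-6 * (j + 1 + r) : ℤ) := by
        rw [← zpow_add₀ hQ]
        congr 1
        push_cast
        ring
      rw [e]
      exact saalSum_eq_zero hQ hQ1 j r (by omega)
  rw [hterm, mul_zero, mul_zero, zero_div] at contig
  rw [mul_right_comm (Q ^ (30 * j + 26 : ℤ) * _ * _ - _), hprod, zero_mul, sub_zero] at contig
  refine (mul_eq_zero.mp contig).resolve_left (mul_ne_zero (mul_ne_zero (zpow_ne_zero _ hQ) ?_) ?_)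
  · rw [← zpow_add₀ hQ]
    intro h
    have := inj _ _ (sub_eq_zero.mp h)
    omega
  · rw [← zpow_add₀ hQ]
    intro h
    have := hQ1 _ (sub_eq_zero.mp h)
    omega

/-- The specialization of the main sum at `a = Q ^ n` vanishes. -/
lemma sum_qPoch_eq_zero {Q α : K} (hQ : Q ≠ 0) (hQ1 : ∀ z : ℤ, Q ^ z = 1 → z = 0) (n : ℕ)
    (hmod : n % 6 = 5) (hα : α = Q ^ n) :
    ∑ k ∈ Finset.range n,
      qPoch (α ^ 5 * Q) (Q ^ 6) k * qPoch (Q * α ^ (-5 : ℤ)) (Q ^ 6) k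
          * qPoch (Q ^ 4) (Q ^ 6) k * Q ^ (6 * k)
        / (qPoch (α ^ 4 * Q ^ 6) (Q ^ 6) k * qPoch (Q ^ 6 * α ^ (-4 : ℤ)) (Q ^ 6) k
            * qPoch (Q ^ 6) (Q ^ 6) k) = 0 := by
  obtain ⟨j, rfl⟩ : ∃ j, n = 6 * j + 4 + 1 := ⟨n / 6, by omega⟩
  rw [← saalSum_eq_zero hQ hQ1 j (4 * j + 3) le_rfl, saalSum, hα]
  refine Finset.sum_congr rfl fun k _ => ?_
  have h1 : (Q ^ (6 * j + 4 + 1)) ^ 5 * Q = Q ^ (30 * j + 26 : ℤ) := by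
    rw [← pow_mul, ← pow_succ, ← zpow_natCast]
    congr 1
    push_cast
    ring
  have h2 : Q * (Q ^ (6 * j + 4 + 1)) ^ (-5 : ℤ)
      = Q ^ (-6 * (j + 1 + (4 * j + 3 : ℕ)) : ℤ) := by
    rw [← zpow_natCast, ← zpow_mul, ← zpow_one_add₀ hQ]
    congr 1
    push_cast
    ring
  have h3 : (Q ^ (6 * j + 4 + 1)) ^ 4 * Q ^ 6 = Q ^ (24 * j + 26 : ℤ) := by
    rw [← pow_mul, ← pow_add, ← zpow_natCast]
    congr 1
    push_cast
    ring
  have h4 : Q ^ 6 * (Q ^ (6 * j + 4 + 1)) ^ (-4 : ℤ)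
      = Q ^ (6 * j + 10 : ℤ) * Q ^ (-6 * (j + 1 + (4 * j + 3 : ℕ)) : ℤ) := by
    rw [← zpow_natCast, ← zpow_natCast, ← zpow_mul, ← zpow_add₀ hQ, ← zpow_add₀ hQ]
    congr 1
    push_cast
    ring
  rw [h1, h2, h3, h4, pow_mul]
  simp only [zpow_ofNat]
  ring

/-- The specialization of the main sum at `a = Q ^ (-n)` vanishes. -/
lemma sum_qPoch_eq_zero_of_inv {Q α : K} (hQ : Q ≠ 0) (hQ1 : ∀ z : ℤ, Q ^ z = 1 → z = 0) (n : ℕ)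
    (hmod : n % 6 = 5) (hα : α⁻¹ = Q ^ n) :
    ∑ k ∈ Finset.range n,
      qPoch (α ^ 5 * Q) (Q ^ 6) k * qPoch (Q * α ^ (-5 : ℤ)) (Q ^ 6) k
          * qPoch (Q ^ 4) (Q ^ 6) k * Q ^ (6 * k)
        / (qPoch (α ^ 4 * Q ^ 6) (Q ^ 6) k * qPoch (Q ^ 6 * α ^ (-4 : ℤ)) (Q ^ 6) k
            * qPoch (Q ^ 6) (Q ^ 6) k) = 0 := by
  rw [← sum_qPoch_eq_zero hQ hQ1 n hmod hα]
  refine Finset.sum_congr rfl fun k _ => ?_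
  have h5 : (α⁻¹) ^ (-5 : ℤ) = α ^ 5 := by rw [inv_zpow', neg_neg, zpow_ofNat]
  have h4 : (α⁻¹) ^ (-4 : ℤ) = α ^ 4 := by rw [inv_zpow', neg_neg, zpow_ofNat]
  have h5' : α ^ (-5 : ℤ) = (α⁻¹) ^ 5 := by rw [zpow_neg, inv_pow, zpow_ofNat]
  have h4' : α ^ (-4 : ℤ) = (α⁻¹) ^ 4 := by rw [zpow_neg, inv_pow, zpow_ofNat]
  rw [h5, h4, h5', h4', mul_comm Q, mul_comm Q, mul_comm (Q ^ 6) (_ ^ 4), mul_comm (Q ^ 6) (_ ^ 4),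
    mul_comm (qPoch (α ^ 5 * Q) (Q ^ 6) k), mul_comm (qPoch (α ^ 4 * Q ^ 6) (Q ^ 6) k)]

end SaalschutzVanishing

section Specialization

variable {K : Type*} [Field K]

/-- `x` is a fraction whose denominator does not vanish under `φ`, and its value is `y`. -/
def EvalsTo (φ : MvP →+* K) (x : FF) (y : K) : Prop :=
  ∃ N D : MvP, φ D ≠ 0 ∧ x = algebraMap MvP FF N / algebraMap MvP FF D ∧ y = φ N / φ D

namespace EvalsTo

variable {φ : MvP →+* K} {x x' : FF} {y y' : K}

lemma algebraMap_ne_zero {D : MvP} (h : φ D ≠ 0) : algebraMap MvP FF D ≠ 0 := by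
  intro h0
  rw [(IsFractionRing.injective MvP FF).eq_iff' (map_zero _)] at h0
  exact h (by rw [h0, map_zero])

lemma of_algebraMap (φ : MvP →+* K) (N : MvP) : EvalsTo φ (algebraMap MvP FF N) (φ N) :=
  ⟨N, 1, by simp, by simp, by simp⟩

lemma one : EvalsTo φ 1 1 := by simpa using of_algebraMap φ 1

lemma zero : EvalsTo φ 0 0 := by simpa using of_algebraMap φ 0

lemma mul (h : EvalsTo φ x y) (h' : EvalsTo φ x' y') : EvalsTo φ (x * x') (y * y') := by
  obtain ⟨N, D, hD, rfl, rfl⟩ := h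
  obtain ⟨N', D', hD', rfl, rfl⟩ := h'
  exact ⟨N * N', D * D', by simp [hD, hD'], by simp [div_mul_div_comm],
    by simp [div_mul_div_comm]⟩

lemma add (h : EvalsTo φ x y) (h' : EvalsTo φ x' y') : EvalsTo φ (x + x') (y + y') := by
  obtain ⟨N, D, hD, rfl, rfl⟩ := h
  obtain ⟨N', D', hD', rfl, rfl⟩ := h'
  refine ⟨N * D' + D * N', D * D', by simp [hD, hD'], ?_, ?_⟩
  · rw [div_add_div _ _ (algebraMap_ne_zero hD) (algebraMap_ne_zero hD')]
    simp
  · rw [div_add_div _ _ hD hD']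
    simp

lemma sub (h : EvalsTo φ x y) (h' : EvalsTo φ x' y') : EvalsTo φ (x - x') (y - y') := by
  have := h.add ((of_algebraMap φ (-1)).mul h')
  simpa [sub_eq_add_neg] using this

lemma inv (h : EvalsTo φ x y) (hy : y ≠ 0) : EvalsTo φ x⁻¹ y⁻¹ := by
  obtain ⟨N, D, hD, rfl, rfl⟩ := h
  exact ⟨D, N, fun h => hy (by rw [h, zero_div]), by simp, by simp⟩

lemma div (h : EvalsTo φ x y) (h' : EvalsTo φ x' y') (hy : y' ≠ 0) :
    EvalsTo φ (x / x') (y / y') := by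
  simpa [div_eq_mul_inv] using h.mul (h'.inv hy)

lemma pow (h : EvalsTo φ x y) (k : ℕ) : EvalsTo φ (x ^ k) (y ^ k) := by
  induction k with
  | zero => simpa using one
  | succ k ih => simpa [pow_succ] using ih.mul h

lemma zpow_neg (h : EvalsTo φ x y) (hy : y ≠ 0) (k : ℕ) :
    EvalsTo φ (x ^ (-k : ℤ)) (y ^ (-k : ℤ)) := by
  simpa using (h.pow k).inv (pow_ne_zero k hy)

lemma poch (h : EvalsTo φ x y) (h' : EvalsTo φ x' y') (k : ℕ) :
    EvalsTo φ (poch x x' k) (qPoch y y' k) := by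
  induction k with
  | zero => simpa [_root_.poch, qPoch] using one
  | succ k ih =>
    rw [qPoch_succ, _root_.poch, Finset.prod_range_succ]
    exact ih.mul (one.sub (h.mul (h'.pow k)))

lemma sum {f : ℕ → FF} {g : ℕ → K} (h : ∀ k, EvalsTo φ (f k) (g k)) (n : ℕ) :
    EvalsTo φ (∑ k ∈ Finset.range n, f k) (∑ k ∈ Finset.range n, g k) := by
  induction n with
  | zero => simpa using zero
  | succ n ih =>
    rw [Finset.sum_range_succ, Finset.sum_range_succ]
    exact ih.add (h n)

end EvalsTo

lemma prime_of_map_eq_zero_iff {φ : MvP →+* K} {P : MvP} (hP0 : P ≠ 0)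
    (hP : ∀ f, φ f = 0 ↔ P ∣ f) : Prime P := by
  refine ⟨hP0, fun hu => ?_, fun f g hfg => ?_⟩
  · have := (hP 1).mpr hu.dvd
    simp at this
  · rw [← hP, map_mul, mul_eq_zero, hP, hP] at hfg
    exact hfg

/-- If the kernel of `φ` consists of the multiples of `P`, then an element of the fraction field
that specializes to `0` has reduced numerator divisible by `P` and denominator prime to `P`. -/
lemma EvalsTo.dvd_num {φ : MvP →+* K} {P : MvP} (hP0 : P ≠ 0) (hP : ∀ f, φ f = 0 ↔ P ∣ f)
    {x : FF} (h : EvalsTo φ x 0) :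
    P ∣ IsFractionRing.num MvP x ∧
      IsRelPrime (IsFractionRing.den MvP x : MvP) P := by
  have hprime := prime_of_map_eq_zero_iff hP0 hP
  obtain ⟨N, D, hD, hx, hy⟩ := h
  have hN : P ∣ N := by
    rw [← hP]
    exact (div_eq_zero_iff.mp hy.symm).resolve_right hD
  have hDP : ¬ P ∣ D := fun h => hD ((hP D).mpr h)
  have hx' := IsFractionRing.mk'_num_den' MvP x
  have hden : algebraMap MvP FF (IsFractionRing.den MvP x : MvP) ≠ 0 := by simp
  have heq : IsFractionRing.num MvP x * D = N * (IsFractionRing.den MvP x : MvP) := by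
    apply IsFractionRing.injective MvP FF
    rw [map_mul, map_mul, ← div_eq_div_iff hden (EvalsTo.algebraMap_ne_zero hD), hx', hx]
  have hnum : P ∣ IsFractionRing.num MvP x :=
    (hprime.dvd_or_dvd (heq ▸ hN.mul_right _)).resolve_right hDP
  refine ⟨hnum, ?_⟩
  refine (hprime.irreducible.isRelPrime_iff_not_dvd.mpr fun hd => hprime.not_isUnit ?_).symm
  exact IsFractionRing.num_den_reduced MvP x hnum hd

end Specialization

section Kernel

open MvPolynomial

lemma ratFunc_X_zpow_eq_one (z : ℤ) (h : (RatFunc.X : RatFunc ℚ) ^ z = 1) : z = 0 := by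
  have key : ∀ m : ℕ, (RatFunc.X : RatFunc ℚ) ^ m = 1 → m = 0 := fun m hm => by
    rw [← RatFunc.algebraMap_X, ← map_pow, ← map_one (algebraMap (Polynomial ℚ) (RatFunc ℚ))] at hm
    have := congrArg Polynomial.natDegree (RatFunc.algebraMap_injective ℚ hm)
    simpa using this
  obtain ⟨m, rfl | rfl⟩ := z.eq_nat_or_neg
  · exact_mod_cast key m (by simpa using h)
  · simpa using key m (by simpa using h)

/-- Modulo a polynomial `P` for which `q ^ e * a` is congruent to a polynomial in `q`, every
polynomial becomes a polynomial in `q` after multiplication by a power of `q`. -/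
lemma exists_dvd_sub_aeval {P : MvP} {e : ℕ} {s : Polynomial ℚ}
    (hP : P ∣ X 1 ^ e * X 0 - Polynomial.aeval (X 1) s) (f : MvP) :
    ∃ (d : ℕ) (g : Polynomial ℚ), P ∣ X 1 ^ d * f - Polynomial.aeval (X 1) g := by
  induction f using MvPolynomial.induction_on with
  | C c => exact ⟨0, Polynomial.C c, by simp [MvPolynomial.algebraMap_eq]⟩
  | add f f' ih ih' =>
    obtain ⟨d, g, h⟩ := ih
    obtain ⟨d', g', h'⟩ := ih'
    refine ⟨d + d', Polynomial.X ^ d' * g + Polynomial.X ^ d * g', ?_⟩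
    convert (h.mul_left (X 1 ^ d')).add (h'.mul_left (X 1 ^ d)) using 1
    simp only [map_add, map_mul, map_pow, Polynomial.aeval_X]
    ring
  | mul_X f i ih =>
    obtain ⟨d, g, h⟩ := ih
    fin_cases i
    · refine ⟨d + e, g * s, ?_⟩
      convert (h.mul_left (X 1 ^ e * X 0)).add (hP.mul_left (Polynomial.aeval (X 1) g)) using 1
      simp only [map_mul, Fin.zero_eta]
      ring
    · refine ⟨d, g * Polynomial.X, ?_⟩
      convert h.mul_left (X 1) using 1
      simp only [map_mul, Polynomial.aeval_X, Fin.mk_one]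
      ring

/-- The specialization `a ↦ α`, `q ↦ q` into the rational functions in `q`. -/
noncomputable def specialization (α : RatFunc ℚ) : MvP →+* RatFunc ℚ :=
  (MvPolynomial.aeval ![α, RatFunc.X] : MvP →ₐ[ℚ] RatFunc ℚ).toRingHom

@[simp]
lemma specialization_X_zero (α : RatFunc ℚ) : specialization α (X 0) = α := by simp [specialization]

@[simp]
lemma specialization_X_one (α : RatFunc ℚ) : specialization α (X 1) = RatFunc.X := by
  simp [specialization]

lemma specialization_aeval (α : RatFunc ℚ) (g : Polynomial ℚ) :
    specialization α (Polynomial.aeval (X 1) g) = algebraMap (Polynomial ℚ) (RatFunc ℚ) g := by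
  induction g using Polynomial.induction_on' with
  | add f g hf hg => rw [map_add, map_add, hf, hg, map_add]
  | monomial n c =>
    rw [← Polynomial.C_mul_X_pow_eq_monomial]
    simp [specialization]

lemma specialization_eq_zero_iff {α : RatFunc ℚ} {P : MvP} {e : ℕ} {s : Polynomial ℚ}
    (hP : P ∣ X 1 ^ e * X 0 - Polynomial.aeval (X 1) s) (hα : specialization α P = 0)
    (hP1 : MvPolynomial.eval ![1, 0] P ≠ 0) (f : MvP) : specialization α f = 0 ↔ P ∣ f := by
  refine ⟨fun hf => ?_, fun ⟨g, hg⟩ => by rw [hg, map_mul, hα, zero_mul]⟩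
  obtain ⟨d, g, hdg⟩ := exists_dvd_sub_aeval hP f
  have hg : g = 0 := by
    obtain ⟨r, hr⟩ := hdg
    have := congrArg (specialization α) hr
    rw [map_sub, map_mul, map_mul, hf, hα, specialization_aeval] at this
    simpa using this
  rw [hg, map_zero, sub_zero] at hdg
  have hX : IsRelPrime (X 1 : MvP) P := by
    refine (MvPolynomial.X_prime (i := 1)).irreducible.isRelPrime_iff_not_dvd.mpr ?_
    rintro ⟨r, rfl⟩
    exact hP1 (by simp)
  exact (hX.pow_left (m := d)).symm.dvd_of_dvd_mul_left hdg

end Kernel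

/-- The main sum specializes to `0` at `a = q ^ n` and `a = q ^ (-n)`. -/
lemma evalsTo_specialization_zero (n : ℕ) (hmod : n % 6 = 5) {α : RatFunc ℚ}
    (hα : α = RatFunc.X ^ n ∨ α⁻¹ = RatFunc.X ^ n) :
    EvalsTo (specialization α) (∑ k ∈ Finset.range n,
        poch (av ^ 5 * qv) (qv ^ 6) k * poch (qv * av ^ (-5 : ℤ)) (qv ^ 6) k
            * poch (qv ^ 4) (qv ^ 6) k * qv ^ (6 * k)
          / (poch (av ^ 4 * qv ^ 6) (qv ^ 6) k * poch (qv ^ 6 * av ^ (-4 : ℤ)) (qv ^ 6) k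
              * poch (qv ^ 6) (qv ^ 6) k)) 0 := by
  have hQ : (RatFunc.X : RatFunc ℚ) ≠ 0 := RatFunc.X_ne_zero
  have ha : EvalsTo (specialization α) av α := by
    simpa [av] using EvalsTo.of_algebraMap (specialization α) (MvPolynomial.X 0)
  have hq : EvalsTo (specialization α) qv RatFunc.X := by
    simpa [qv] using EvalsTo.of_algebraMap (specialization α) (MvPolynomial.X 1)
  obtain ⟨z, hz, hzα⟩ : ∃ z : ℤ, z % 3 ≠ 0 ∧ α = RatFunc.X ^ z := by
    rcases hα with h | h
    · exact ⟨n, by omega, by rw [h, zpow_natCast]⟩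
    · exact ⟨-n, by omega, by rw [zpow_neg, zpow_natCast, ← h, inv_inv]⟩
  have hα0 : α ≠ 0 := by
    rw [hzα]
    exact zpow_ne_zero _ hQ
  have ne1 : ∀ w : ℤ, w ≠ 0 → 1 - (RatFunc.X : RatFunc ℚ) ^ w ≠ 0 := fun w hw h =>
    hw (ratFunc_X_zpow_eq_one w (sub_eq_zero.mp h).symm)
  have hsum : ∑ k ∈ Finset.range n,
      qPoch (α ^ 5 * RatFunc.X) (RatFunc.X ^ 6) k
          * qPoch (RatFunc.X * α ^ (-5 : ℤ)) (RatFunc.X ^ 6) k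
          * qPoch (RatFunc.X ^ 4) (RatFunc.X ^ 6) k * RatFunc.X ^ (6 * k)
        / (qPoch (α ^ 4 * RatFunc.X ^ 6) (RatFunc.X ^ 6) k
            * qPoch (RatFunc.X ^ 6 * α ^ (-4 : ℤ)) (RatFunc.X ^ 6) k
            * qPoch (RatFunc.X ^ 6) (RatFunc.X ^ 6) k) = 0 :=
    hα.elim (sum_qPoch_eq_zero hQ ratFunc_X_zpow_eq_one n hmod)
      (sum_qPoch_eq_zero_of_inv hQ ratFunc_X_zpow_eq_one n hmod)
  rw [← hsum]
  refine EvalsTo.sum (fun k => ?_) n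
  have hq6 := hq.pow 6
  refine EvalsTo.div ?_ ?_ ?_
  · exact (((((ha.pow 5).mul hq).poch hq6 k).mul ((hq.mul (ha.zpow_neg hα0 5)).poch hq6 k)).mul
      ((hq.pow 4).poch hq6 k)).mul (hq.pow (6 * k))
  · exact ((((ha.pow 4).mul hq6).poch hq6 k).mul ((hq6.mul (ha.zpow_neg hα0 4)).poch hq6 k)).mul
      (hq6.poch hq6 k)
  · refine mul_ne_zero (mul_ne_zero (qPoch_ne_zero fun i => ?_) (qPoch_ne_zero fun i => ?_))
      (qPoch_ne_zero fun i => ?_)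
    all_goals
      simp only [hzα, ← zpow_natCast, ← zpow_mul, ← zpow_add₀ hQ]
      exact ne1 _ (by push_cast; omega)

theorem stmt10 (n : ℕ) (hn : 0 < n) (hmod : n % 6 = 5) :
    CongrZero
      (∑ k ∈ Finset.range n,
        poch (av ^ 5 * qv) (qv ^ 6) k * poch (qv * av ^ (-5 : ℤ)) (qv ^ 6) k
            * poch (qv ^ 4) (qv ^ 6) k * qv ^ (6 * k)
          / (poch (av ^ 4 * qv ^ 6) (qv ^ 6) k * poch (qv ^ 6 * av ^ (-4 : ℤ)) (qv ^ 6) k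
              * poch (qv ^ 6) (qv ^ 6) k))
      ((1 - MvPolynomial.X 0 * MvPolynomial.X 1 ^ n)
        * (MvPolynomial.X 0 - MvPolynomial.X 1 ^ n)) := by
  set A : FF := ∑ k ∈ Finset.range n, _ with hA
  have hX : (RatFunc.X : RatFunc ℚ) ≠ 0 := RatFunc.X_ne_zero
  have hker₁ := specialization_eq_zero_iff (α := (RatFunc.X ^ n)⁻¹) (e := n) (s := 1)
    (P := 1 - MvPolynomial.X 0 * MvPolynomial.X 1 ^ n)
    (by rw [map_one, ← dvd_neg]; exact dvd_of_eq (by ring)) (by simp [hX]) (by simp [hn.ne'])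
  have hker₂ := specialization_eq_zero_iff (α := RatFunc.X ^ n) (e := 0) (s := Polynomial.X ^ n)
    (P := MvPolynomial.X 0 - MvPolynomial.X 1 ^ n) (by simp) (by simp) (by simp [hn.ne'])
  have hP₁ : (1 - MvPolynomial.X 0 * MvPolynomial.X 1 ^ n : MvP) ≠ 0 := fun h => by
    simpa [hn.ne'] using congrArg (MvPolynomial.eval ![1, 0]) h
  obtain ⟨hnum₁, hden₁⟩ := EvalsTo.dvd_num hP₁ hker₁
    (evalsTo_specialization_zero n hmod (Or.inr (inv_inv _)))
  have hP₂ : (MvPolynomial.X 0 - MvPolynomial.X 1 ^ n : MvP) ≠ 0 := fun h => by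
    simpa [hn.ne'] using congrArg (MvPolynomial.eval ![1, 0]) h
  obtain ⟨hnum₂, hden₂⟩ := EvalsTo.dvd_num hP₂ hker₂
    (evalsTo_specialization_zero n hmod (Or.inl rfl))
  rw [← hA] at hnum₁ hnum₂ hden₁ hden₂
  have hrel : IsRelPrime (1 - MvPolynomial.X 0 * MvPolynomial.X 1 ^ n : MvP)
      (MvPolynomial.X 0 - MvPolynomial.X 1 ^ n) := by
    refine (prime_of_map_eq_zero_iff hP₁ hker₁).irreducible.isRelPrime_iff_not_dvd.mpr fun h => ?_
    rw [← hker₁, map_sub, map_pow, specialization_X_zero, specialization_X_one, sub_eq_zero] at h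
    have := ratFunc_X_zpow_eq_one (n + n) (by
      rw [zpow_add₀ hX, zpow_natCast, ← inv_mul_cancel₀ (pow_ne_zero n hX), h])
    omega
  obtain ⟨B, hB⟩ := hrel.mul_dvd hnum₁ hnum₂
  refine ⟨B, IsFractionRing.den MvP A, nonZeroDivisors.coe_ne_zero _, hden₁.mul_right hden₂, ?_⟩
  rw [← mul_div_assoc, ← map_mul, ← hB, IsFractionRing.mk'_num_den']
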